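/- Let φ : ℂ → ℝ be continuous. Then there is no closed simple flow-line of the unit vector field e^{iφ}: there do not exist T > 0 and a differentiable curve η : [0,T] → ℂ with η'(t) = exp(i·φ(η(t))) for all t ∈ [0,T], η(0) = η(T), and η injective on [0,T). -/

import Mathlib

/-- A continuous function on the plane whose exponential is constant is constant. -/
lemma const_of_exp_const {X : Type*} [TopologicalSpace X] [SimplyConnectedSpace X]
    [LocallyPathConnectedSpace X] (f : X → ℂ) (hf : Continuous f) (w : ℂ)
    (h : ∀ x, Complex.exp (f x) = w) (x y : X) : f x = f y := by
  have hw : w ≠ 0 := by rw [← h x]; exact Complex.exp_ne_zero _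
  have hu := (Complex.isCoveringMapOn_exp.existsUnique_continuousMap_lifts
    (A := X) (ContinuousMap.const X w) (a₀ := y) (e₀ := f y) (h y) (fun _ => hw)).unique
    (y₁ := ⟨f, hf⟩) (y₂ := ContinuousMap.const X (f y))
    ⟨rfl, by ext x; simp [h x]⟩ ⟨rfl, by ext x; simp [h y]⟩
  simpa using congrArg (fun F : C(X, ℂ) => F x) hu

/-- Averaged velocity over the interval from `s` to `s + h`. -/
noncomputable def avgV (v : ℝ → ℂ) (s h : ℝ) : ℂ := ∫ u in (0:ℝ)..1, v (s + h * u)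

lemma avgV_mul (v : ℝ → ℂ) (s h : ℝ) : h • avgV v s h = ∫ x in s..s + h, v x := by
  unfold avgV
  rw [intervalIntegral.smul_integral_comp_add_mul]
  simp

lemma avgV_zero (v : ℝ → ℂ) (s : ℝ) : avgV v s 0 = v s := by
  simp [avgV]

lemma avgV_refl (v : ℝ → ℂ) (s h : ℝ) : avgV v (s + h) (-h) = avgV v s h := by
  unfold avgV
  have := intervalIntegral.integral_comp_sub_left (a := 0) (b := 1)
    (fun u => v (s + h * u)) (1:ℝ)
  simp only [sub_self, sub_zero] at this
  rw [← this]
  congr 1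
  ext u
  congr 1
  ring

lemma avgV_per (v : ℝ → ℂ) (T : ℝ) (hv : Function.Periodic v T) (s h : ℝ) :
    avgV v (s + T) h = avgV v s h := by
  unfold avgV
  congr 1
  ext u
  rw [← hv (s + h * u)]
  congr 1
  ring

lemma avgV_cont (v : ℝ → ℂ) (hv : Continuous v) :
    Continuous (fun p : ℝ × ℝ => avgV v p.1 p.2) := by
  unfold avgV
  apply intervalIntegral.continuous_parametric_intervalIntegral_of_continuous'
  fun_prop

/-- The (odd) rotation number argument. -/
lemma rotation_core (T : ℝ) (hT : 0 < T) (ψ : ℝ → ℝ) (hψ : Continuous ψ)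
    (hper : Function.Periodic ψ T)
    (h0 : ∀ s, ∫ x in s..s + -T, Complex.exp (Complex.I * (ψ x : ℂ)) = 0)
    (hne : ∀ s h, 0 < h → h < T →
      ∫ x in s..s + h, Complex.exp (Complex.I * (ψ x : ℂ)) ≠ 0)
    (hne' : ∀ s h, ∫ x in s..s + (h - T), Complex.exp (Complex.I * (ψ x : ℂ)) =
      ∫ x in s..s + h, Complex.exp (Complex.I * (ψ x : ℂ))) : False := by
  set v : ℝ → ℂ := fun x => Complex.exp (Complex.I * (ψ x : ℂ)) with hv
  have hvc : Continuous v := by rw [hv]; fun_prop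
  have hvp : Function.Periodic v T := fun x => by simp [hv, hper x]
  let G : ℝ → ℝ → ℂ := fun s h => avgV v s h - avgV v s (h - T)
  have hGsym : ∀ s h, G (s + h) (T - h) = - G s h := by
    intro s h
    have e1 : avgV v (s + h) (T - h) = avgV v s (h - T) := by
      rw [← avgV_refl v s (h - T), ← avgV_per v T hvp (s + (h - T))]
      congr 1 <;> ring
    have e2 : avgV v (s + h) (T - h - T) = avgV v s h := by
      rw [← avgV_refl v s h]
      congr 1
      ring
    simp only [G, e1, e2]
    ring
  have hG0 : ∀ s, G s 0 = v s := by
    intro s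
    have h1 := avgV_mul v s (-T)
    rw [h0 s] at h1
    have h2 : avgV v s (-T) = 0 := by
      rcases smul_eq_zero.1 h1 with h | h
      · linarith
      · exact h
    simp [G, avgV_zero, h2]
  have hGne : ∀ s h, 0 ≤ h → h ≤ T → G s h ≠ 0 := by
    intro s h hh0 hhT
    rcases hh0.eq_or_lt with rfl | hpos
    · rw [hG0]; exact Complex.exp_ne_zero _
    rcases hhT.eq_or_lt with rfl | hlt
    · have := hGsym s h
      rw [sub_self, hG0] at this
      intro h3
      rw [h3, neg_zero] at this
      exact Complex.exp_ne_zero _ this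
    · intro h3
      have h4 : avgV v s h = avgV v s (h - T) := sub_eq_zero.1 h3
      have h5 := avgV_mul v s h
      have h6 := avgV_mul v s (h - T)
      rw [hne' s h, ← h5, ← h4, sub_smul] at h6
      have h7 : T • avgV v s h = 0 := by
        simpa using h6
      apply hne s h hpos hlt
      rw [← h5]
      rcases smul_eq_zero.1 h7 with h | h
      · linarith
      · rw [h, smul_zero]
  let c : ℝ → ℝ := fun h => max 0 (min h T)
  have hc : Continuous c := by fun_prop
  have hcT : ∀ h, c (T - h) = T - c h := by
    intro h
    simp only [c, max_def, min_def]
    split_ifs <;> linarith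
  have hc0 : ∀ h, 0 ≤ c h := fun h => le_max_left _ _
  have hc1 : ∀ h, c h ≤ T := fun h => max_le hT.le (min_le_right _ _)
  have c0 : c 0 = 0 := by simp [c, hT.le]
  have cT : c T = T := by simp [c, hT.le]
  have hGc : Continuous (fun p : ℝ × ℝ => G p.1 (c p.2)) := by
    have a := avgV_cont v hvc
    have b1 : Continuous (fun p : ℝ × ℝ => (p.1, c p.2)) := by fun_prop
    have b2 : Continuous (fun p : ℝ × ℝ => (p.1, c p.2 - T)) := by fun_prop
    exact (a.comp b1).sub (a.comp b2)
  obtain ⟨L, ⟨-, hL⟩, -⟩ := Complex.isCoveringMapOn_exp.existsUnique_continuousMap_lifts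
    (A := ℝ × ℝ) ⟨_, hGc⟩ (a₀ := (0, 0)) (e₀ := Complex.log (G 0 (c 0)))
    (Complex.exp_log (hGne _ _ (hc0 _) (hc1 _))) (fun p => hGne _ _ (hc0 _) (hc1 _))
  have hL' : ∀ s h, Complex.exp (L (s, h)) = G s (c h) := fun s h => congrFun hL (s, h)
  have hLc : Continuous L := L.continuous
  have k1 := const_of_exp_const (fun s : ℝ => L (s, 0) - Complex.I * (ψ s : ℂ))
    (by fun_prop) 1
    (fun s => by
      rw [Complex.exp_sub, hL', c0, hG0]
      exact div_self (Complex.exp_ne_zero _)) T 0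
  have hψT : ψ T = ψ 0 := by simpa using hper 0
  have k1' : L (T, 0) = L (0, 0) := by simpa [hψT] using k1
  have k2 := fun p q => const_of_exp_const
    (fun p : ℝ × ℝ => L (p.1 + c p.2, T - p.2) - L (p.1, p.2))
    (by fun_prop) (-1)
    (fun p => by
      rw [Complex.exp_sub, hL', hL', hcT, hGsym, neg_div, div_self (hGne _ _ (hc0 _) (hc1 _))])
      p q
  have k3 := k2 (0, 0) (0, T)
  simp only [c0, cT, zero_add, sub_zero, sub_self, k1'] at k3
  have k4 : L (0, T) - L (0, 0) = 0 := by
    linear_combination k3 / 2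
  have k5 : Complex.exp (L (0, T)) = - Complex.exp (L (0, 0)) := by
    have := hGsym 0 0
    rw [hL', hL', c0, cT]
    simpa using this
  rw [sub_eq_zero.1 k4] at k5
  exact Complex.exp_ne_zero _ (self_eq_neg.1 k5)

/-- **No closed simple flow-line.** If `φ : ℂ → ℝ` is continuous, then there is no closed
simple flow-line of the unit vector field `e^{iφ}`: no `T > 0` and differentiable curve
`η` with `η'(t) = exp(i φ(η(t)))` on `[0,T]`, `η(0) = η(T)`, and `η` injective on `[0,T)`. -/
theorem no_closed_simple_flow_line (φ : ℂ → ℝ) (hφ : Continuous φ) :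
    ¬ ∃ (T : ℝ) (η : ℝ → ℂ), 0 < T ∧
      (∀ t ∈ Set.Icc (0:ℝ) T,
        HasDerivAt η (Complex.exp (Complex.I * (φ (η t) : ℂ))) t) ∧
      η 0 = η T ∧ Set.InjOn η (Set.Ico 0 T) := by
  rintro ⟨T, η, hT, hd, hcl, hinj⟩
  haveI : Fact (0 < T) := ⟨hT⟩
  have hηc : ContinuousOn η (Set.Icc 0 T) := fun t ht => (hd t ht).continuousAt.continuousWithinAt
  let ψ : ℝ → ℝ := fun t => AddCircle.liftIco T 0 (fun t => φ (η t)) (t : AddCircle T)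
  have hψ : Continuous ψ :=
    (AddCircle.liftIco_zero_continuous (by simp [hcl]) (hφ.comp_continuousOn hηc)).comp
      (AddCircle.continuous_mk' T)
  have hper : Function.Periodic ψ T := fun t => by
    simp only [ψ, AddCircle.coe_add_period]
  have hψeq : ∀ t ∈ Set.Icc 0 T, ψ t = φ (η t) := by
    intro t ht
    rcases ht.2.eq_or_lt with h | h
    · have h1 : ψ T = ψ 0 := by simpa using hper 0
      have h2 : ψ 0 = φ (η 0) := AddCircle.liftIco_zero_coe_apply ⟨le_rfl, hT⟩
      rw [h, h1, h2, hcl]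
    · exact AddCircle.liftIco_zero_coe_apply ⟨ht.1, h⟩
  let v : ℝ → ℂ := fun x => Complex.exp (Complex.I * (ψ x : ℂ))
  have hvc : Continuous v := by fun_prop
  have hvp : Function.Periodic v T := fun x => by simp [v, hper x]
  have hvi : ∀ a b, IntervalIntegrable v MeasureTheory.volume a b :=
    fun a b => hvc.intervalIntegrable a b
  let E : ℝ → ℂ := fun t => ∫ x in (0:ℝ)..t, v x
  have hEsub : ∀ a b, ∫ x in a..b, v x = E b - E a := fun a b =>
    (intervalIntegral.integral_interval_sub_left (hvi _ _) (hvi _ _)).symm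
  have hEη : ∀ t ∈ Set.Icc 0 T, E t = η t - η 0 := by
    intro t ht
    apply intervalIntegral.integral_eq_sub_of_hasDerivAt _ (hvi _ _)
    intro x hx
    rw [Set.uIcc_of_le ht.1] at hx
    have hx' : x ∈ Set.Icc 0 T := ⟨hx.1, hx.2.trans ht.2⟩
    have := hd x hx'
    rw [← hψeq x hx'] at this
    exact this
  have hET : ∀ s, E (s + T) = E s := by
    intro s
    have h1 := hvp.intervalIntegral_add_eq s 0
    rw [hEsub, zero_add, hEsub, hEη T ⟨hT.le, le_rfl⟩, hEη 0 ⟨le_rfl, hT.le⟩, hcl] at h1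
    simpa [sub_eq_zero] using h1
  have hEp : Function.Periodic E T := hET
  refine rotation_core T hT ψ hψ hper ?_ ?_ ?_
  · intro s
    change ∫ x in s..s + -T, v x = 0
    rw [hEsub, ← hET (s + -T)]
    simp
  · intro s h hpos hlt
    change ∫ x in s..s + h, v x ≠ 0
    rw [hEsub]
    intro h0
    have hmod : ∀ x, η (toIcoMod hT 0 x) = E x + η 0 := by
      intro x
      have hm := toIcoMod_mem_Ico' hT x
      have h1 := hEη _ ⟨hm.1, hm.2.le⟩
      have h2 : E (toIcoMod hT 0 x) = E x := hEp.sub_zsmul_eq _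
      rw [← h2, h1]
      ring
    have h1 : toIcoMod hT 0 s = toIcoMod hT 0 (s + h) := by
      apply hinj (toIcoMod_mem_Ico' hT _) (toIcoMod_mem_Ico' hT _)
      rw [hmod, hmod, sub_eq_zero.1 h0]
    obtain ⟨n, hn⟩ := (toIcoMod_eq_toIcoMod hT).1 h1
    rw [add_sub_cancel_left, zsmul_eq_mul] at hn
    have n1 : (0:ℝ) < n := by
      by_contra hcon
      nlinarith
    have n2 : (n:ℝ) < 1 := by
      by_contra hcon
      nlinarith
    have n1' : 0 < n := by exact_mod_cast n1
    have n2' : n < 1 := by exact_mod_cast n2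
    omega
  · intro s h
    change ∫ x in s..s + (h - T), v x = ∫ x in s..s + h, v x
    rw [hEsub, hEsub, ← hET (s + (h - T))]
    congr 2
    ring
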